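/- Let A be an integral domain which is a smooth, finitely generated ℂ-algebra of Krull dimension 1 (the coordinate ring of a smooth affine curve over ℂ), and let 𝔪₁, …, 𝔪_N be pairwise distinct maximal ideals of A. Then there exist elements f, g ∈ A and pairwise distinct scalars λ₁, …, λ_N ∈ ℂ such that: (a) g ∉ 𝔪_i for all i = 1, …, N; (b) f − λ_i ∈ 𝔪_i for all i; and (c) the localization A_g = A[1/g], viewed as a ℂ[X]-algebra via the homomorphism ℂ[X] → A_g sending X to the image of f, is an étale ℂ[X]-algebra (i.e., formally étale and of finite presentation). (This is Lemma 2.8: given distinct points c₁,…,c_N on a smooth curve C, there is an open subset C' ⊆ C containing them and an étale morphism p : C' → 𝔸¹ with p(c₁),…,p(c_N) pairwise distinct.) -/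

import Mathlib

open TensorProduct
theorem aux_dim (A : Type) [CommRing A] [IsDomain A] [Algebra ℂ A] (hdim : ringKrullDim A = 1)
    (s : ℕ) [Algebra (MvPolynomial (Fin s) ℂ) A] [Algebra.IsIntegral (MvPolynomial (Fin s) ℂ) A]
    (hinj : Function.Injective (algebraMap (MvPolynomial (Fin s) ℂ) A)) : s = 1 := by
  have hd : ringKrullDim (MvPolynomial (Fin s) ℂ) = s := by simp
  have : FaithfulSMul (MvPolynomial (Fin s) ℂ) A := (faithfulSMul_iff_algebraMap_injective _ _).mpr hinj
  apply le_antisymm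
  · have hA : Ring.KrullDimLE 1 A := by
      rw [Ring.krullDimLE_iff, hdim]; rfl
    have : Ring.KrullDimLE 1 (MvPolynomial (Fin s) ℂ) := by
      refine Ring.KrullDimLE.mk₁' fun P hP hp => ?_
      obtain ⟨Q, hQ, hQ2⟩ := Ideal.nonempty_primesOver (S := A) P
      have : Q ≠ ⊥ := by
        rintro rfl
        apply hP
        rw [hQ2.over]
        exact Ideal.comap_bot_of_injective _ hinj
      have := hQ.isMaximal_of_ne_bot this
      exact Ideal.IsMaximal.of_isMaximal_liesOver Q P
    rw [Ring.krullDimLE_iff, hd] at this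
    exact_mod_cast this
  · have : ringKrullDim A ≤ ringKrullDim (MvPolynomial (Fin s) ℂ) := by
      refine Order.krullDim_le_of_strictMono
        (PrimeSpectrum.comap (algebraMap (MvPolynomial (Fin s) ℂ) A)) fun I J hIJ => ?_
      exact Ideal.IsIntegral.comap_lt_comap hIJ
    rw [hdim, hd] at this
    exact_mod_cast this

theorem aux_rank (A : Type) [CommRing A] [IsDomain A] [Algebra ℂ A]
    [Algebra.FinitePresentation ℂ A] (hdim : ringKrullDim A = 1) :
    Module.finrank A Ω[A⁄ℂ] = 1 := by
  obtain ⟨s, g, hg, hi⟩ := exists_integral_inj_algHom_of_fg ℂ A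
  algebraize [g.toRingHom]
  have hinj : Function.Injective (algebraMap (MvPolynomial (Fin s) ℂ) A) := hg
  have : Algebra.IsIntegral (MvPolynomial (Fin s) ℂ) A := ⟨hi⟩
  obtain rfl := aux_dim A hdim s hinj
  have : FaithfulSMul (MvPolynomial (Fin 1) ℂ) A := (faithfulSMul_iff_algebraMap_injective _ _).mpr hinj
  let R := MvPolynomial (Fin 1) ℂ
  let F := FractionRing R
  let K := FractionRing A
  have : FaithfulSMul R K := .trans R A K
  let : Algebra F K := FractionRing.liftAlgebra R K
  have : IsScalarTower R F K := inferInstance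
  have : Algebra.IsAlgebraic F K := inferInstance
  have : CharZero F := inferInstance
  have : Algebra.FormallyEtale F K := Algebra.FormallyEtale.of_isSeparable F K
  have : Algebra.FormallyEtale R F := Algebra.FormallyEtale.of_isLocalization (nonZeroDivisors R)
  have : Algebra.FormallyEtale R K := Algebra.FormallyEtale.comp R F K
  have : Algebra.FormallyEtale A K := Algebra.FormallyEtale.of_isLocalization (nonZeroDivisors A)
  have h1 := (KaehlerDifferential.tensorKaehlerEquivOfFormallyEtale ℂ R K).finrank_eq
  have h2 := (KaehlerDifferential.tensorKaehlerEquivOfFormallyEtale ℂ A K).finrank_eq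
  have h3 := (TensorProduct.isBaseChange A Ω[A⁄ℂ] K).finrank_eq
  have b := KaehlerDifferential.mvPolynomialBasis ℂ (Fin 1)
  have : Module.Free R Ω[R⁄ℂ] := .of_basis b
  have h4 : Module.finrank K (K ⊗[R] Ω[R⁄ℂ]) = Module.finrank R Ω[R⁄ℂ] := Module.finrank_baseChange
  have h5 : Module.finrank R Ω[R⁄ℂ] = 1 := by simpa using Module.finrank_eq_card_basis b
  rw [← h3, h2, ← h1, h4, h5]

theorem aux_fiber (A M : Type) [CommRing A] [IsDomain A] [AddCommGroup M] [Module A M]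
    [Module.Finite A M] [Module.Flat A M] (hr : Module.finrank A M = 1) (m : Ideal A)
    [m.IsMaximal] :
    (∃ y : M, y ∉ m • (⊤ : Submodule A M)) ∧ ∀ x : M, x ∉ m • (⊤ : Submodule A M) →
      ∃ r : A, r ∉ m ∧ ∀ y : M, r • y ∈ Submodule.span A {x} := by
  have h1 : Module.finrank m.ResidueField (m.ResidueField ⊗[A] M) = 1 :=
    (m.finrank_fiber_eq_finrank (M := M)).trans hr
  have hbij := m.bijective_algebraMap_quotient_residueField
  let e0 : (A ⧸ m) ≃ₗ[A] m.ResidueField :=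
    LinearEquiv.ofBijective (IsScalarTower.toAlgHom A (A ⧸ m) m.ResidueField).toLinearMap hbij
  let e : m.ResidueField ⊗[A] M ≃ₗ[A] M ⧸ (m • (⊤ : Submodule A M)) :=
    (TensorProduct.congr e0.symm (LinearEquiv.refl A M)).trans
      (TensorProduct.quotTensorEquivQuotSMul M m)
  have he : ∀ y : M, e (1 ⊗ₜ y) = Submodule.Quotient.mk y := by
    intro y
    have : e0.symm 1 = Ideal.Quotient.mk m 1 := by
      rw [LinearEquiv.symm_apply_eq]
      exact (map_one (algebraMap (A ⧸ m) m.ResidueField)).symm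
    simp only [e, LinearEquiv.trans_apply, TensorProduct.congr_tmul, this]
    simp
  have hz : ∀ y : M, (1 : m.ResidueField) ⊗ₜ[A] y = 0 ↔ y ∈ m • (⊤ : Submodule A M) := by
    intro y
    rw [← Submodule.Quotient.mk_eq_zero, ← he, e.map_eq_zero_iff]
  constructor
  · by_contra! hcon
    have : Subsingleton (M ⧸ (m • (⊤ : Submodule A M))) := by
      rw [Submodule.Quotient.subsingleton_iff, eq_top_iff]
      exact fun y _ => hcon y
    have := e.toEquiv.subsingleton
    rw [Module.finrank_zero_of_subsingleton] at h1
    exact zero_ne_one h1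
  · intro x hx
    have hx' := mt (hz x).mp hx
    have hspan := (finrank_eq_one_iff_of_nonzero' _ hx').mp h1
    have key : ∀ y : M, ∃ a : A, y - a • x ∈ m • (⊤ : Submodule A M) := by
      intro y
      obtain ⟨c, hc⟩ := hspan (1 ⊗ₜ y)
      obtain ⟨a, rfl⟩ := m.algebraMap_residueField_surjective c
      refine ⟨a, (hz _).mp ?_⟩
      rw [TensorProduct.tmul_sub, TensorProduct.tmul_smul, ← hc, algebraMap_smul, sub_self]
    obtain ⟨r, hr1, hr2⟩ := Submodule.exists_sub_one_mem_and_smul_eq_zero_of_fg_of_le_smul m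
      (⊤ : Submodule A (M ⧸ Submodule.span A {x})) Module.Finite.fg_top (by
        rintro z -
        obtain ⟨y, rfl⟩ := Submodule.Quotient.mk_surjective _ z
        obtain ⟨a, ha⟩ := key y
        have h2 : (Submodule.span A {x}).mkQ (y - a • x) ∈
            (m • (⊤ : Submodule A M)).map (Submodule.span A {x}).mkQ :=
          Submodule.mem_map_of_mem ha
        rw [Submodule.map_smul'', Submodule.map_top, Submodule.range_mkQ] at h2
        have h3 : (Submodule.span A {x}).mkQ (a • x) = 0 := by
          rw [Submodule.mkQ_apply, Submodule.Quotient.mk_eq_zero]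
          exact Submodule.smul_mem _ _ (Submodule.mem_span_singleton_self x)
        rwa [map_sub, h3, sub_zero] at h2)
    refine ⟨r, fun h => ?_, fun y => ?_⟩
    · apply Ideal.IsPrime.ne_top' (I := m)
      rw [Ideal.eq_top_iff_one]
      simpa using m.sub_mem h hr1
    · have := hr2 (Submodule.Quotient.mk y) trivial
      rwa [← Submodule.Quotient.mk_smul, Submodule.Quotient.mk_eq_zero] at this

theorem aux_etale (A : Type) [CommRing A] [IsDomain A] [Algebra ℂ A]
    [Algebra.FormallySmooth ℂ A]
    [Algebra (Polynomial ℂ) A] [IsScalarTower ℂ (Polynomial ℂ) A] (f : A)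
    (hf : algebraMap (Polynomial ℂ) A Polynomial.X = f)
    (hD : KaehlerDifferential.D ℂ A f ≠ 0) (g : A)
    (hg : ∀ y : Ω[A⁄ℂ], g • y ∈ Submodule.span A {KaehlerDifferential.D ℂ A f})
    (B : Type) [CommRing B] [Algebra A B] [Algebra (Polynomial ℂ) B]
    [IsScalarTower (Polynomial ℂ) A B] [IsLocalization.Away g B] :
    Algebra.FormallyEtale (Polynomial ℂ) B := by
  have hinj : Function.Injective (KaehlerDifferential.mapBaseChange ℂ (Polynomial ℂ) A) := by
    rw [injective_iff_map_eq_zero]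
    intro z hz
    have : ∃ a : A, z = a ⊗ₜ KaehlerDifferential.D ℂ (Polynomial ℂ) Polynomial.X := by
      clear hz
      induction z with
      | zero => exact ⟨0, by simp⟩
      | tmul a w =>
        obtain ⟨p, rfl⟩ := (KaehlerDifferential.polynomialEquiv ℂ).symm.surjective w
        refine ⟨p • a, ?_⟩
        rw [KaehlerDifferential.polynomialEquiv_symm, TensorProduct.smul_tmul]
      | add x y hx hy =>
        obtain ⟨a, rfl⟩ := hx
        obtain ⟨b, rfl⟩ := hy
        exact ⟨a + b, by rw [TensorProduct.add_tmul]⟩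
    obtain ⟨a, rfl⟩ := this
    rw [KaehlerDifferential.mapBaseChange_tmul, KaehlerDifferential.map_D, hf] at hz
    have : Module.IsTorsionFree A Ω[A⁄ℂ] := inferInstance
    rcases smul_eq_zero.mp hz with h | h
    · simp [h]
    · exact absurd h hD
  have hH : Subsingleton (Algebra.H1Cotangent (Polynomial ℂ) A) := by
    refine subsingleton_of_forall_eq 0 fun x => ?_
    have h1 : Algebra.H1Cotangent.δ ℂ (Polynomial ℂ) A x = 0 := by
      apply hinj
      rw [map_zero]
      exact (Algebra.H1Cotangent.exact_δ_mapBaseChange ℂ (Polynomial ℂ) A _).mpr ⟨x, rfl⟩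
    obtain ⟨y, rfl⟩ := (Algebra.H1Cotangent.exact_map_δ ℂ (Polynomial ℂ) A x).mp h1
    rw [Subsingleton.elim y 0, map_zero]
  have hO : ∀ z : Ω[A⁄Polynomial ℂ], g • z = 0 := by
    intro z
    obtain ⟨y, rfl⟩ := KaehlerDifferential.map_surjective ℂ (Polynomial ℂ) A z
    rw [← map_smul]
    obtain ⟨a, ha⟩ := Submodule.mem_span_singleton.mp (hg y)
    rw [← ha, map_smul, KaehlerDifferential.map_D, Algebra.algebraMap_self_apply, ← hf,
      Derivation.map_algebraMap, smul_zero]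
  refine ⟨?_, ?_⟩
  · exact (IsLocalizedModule.subsingleton_iff (.powers g)
      (KaehlerDifferential.map (Polynomial ℂ) (Polynomial ℂ) A B)).mpr
      fun z => ⟨g, Submonoid.mem_powers g, hO z⟩
  · exact (IsLocalizedModule.subsingleton_iff (.powers g)
      (Algebra.H1Cotangent.map (Polynomial ℂ) (Polynomial ℂ) A B)).mpr
      fun z => ⟨1, one_mem _, Subsingleton.elim _ _⟩

theorem aux_etale2 (A : Type) [CommRing A] [IsDomain A] [Algebra ℂ A]
    [Algebra.FormallySmooth ℂ A] (f : A)
    (hD : KaehlerDifferential.D ℂ A f ≠ 0) (g : A)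
    (hg : ∀ y : Ω[A⁄ℂ], g • y ∈ Submodule.span A {KaehlerDifferential.D ℂ A f})
    (B : Type) [CommRing B] [Algebra A B] [Algebra ℂ B] [IsScalarTower ℂ A B]
    [Algebra (Polynomial ℂ) B] [IsLocalization.Away g B]
    (hB : algebraMap (Polynomial ℂ) B = (Polynomial.aeval (algebraMap A B f)).toRingHom) :
    Algebra.FormallyEtale (Polynomial ℂ) B := by
  let : Algebra (Polynomial ℂ) A := (Polynomial.aeval f).toRingHom.toAlgebra
  have : IsScalarTower ℂ (Polynomial ℂ) A := .of_algebraMap_eq fun c => by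
    rw [RingHom.algebraMap_toAlgebra]; simp
  have : IsScalarTower (Polynomial ℂ) A B :=
    .of_algebraMap_eq fun p => by
      rw [hB, RingHom.algebraMap_toAlgebra]
      exact Polynomial.aeval_algebraMap_apply _ _ _
  refine aux_etale A f ?_ hD g hg B
  rw [RingHom.algebraMap_toAlgebra]; simp

theorem aux_D_mem (A : Type) [CommRing A] [Algebra ℂ A] (m : Ideal A) (x : A) (hx : x ∈ m ^ 2) :
    KaehlerDifferential.D ℂ A x ∈ m • (⊤ : Submodule A Ω[A⁄ℂ]) := by
  rw [pow_two] at hx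
  induction hx using Submodule.mul_induction_on' with
  | mem_mul_mem a ha b hb =>
    rw [Derivation.leibniz]
    exact add_mem (Submodule.smul_mem_smul ha trivial) (Submodule.smul_mem_smul hb trivial)
  | add a _ b _ ha hb => rw [map_add]; exact add_mem ha hb

theorem aux_local (A : Type) [CommRing A] [Algebra ℂ A] [Algebra.FiniteType ℂ A]
    (m : Ideal A) [m.IsMaximal] (hy : ∃ y : Ω[A⁄ℂ], y ∉ m • (⊤ : Submodule A Ω[A⁄ℂ])) :
    ∃ a : A, a ∈ m ∧ KaehlerDifferential.D ℂ A a ∉ m • (⊤ : Submodule A Ω[A⁄ℂ]) := by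
  have : ∃ a : A, KaehlerDifferential.D ℂ A a ∉ m • (⊤ : Submodule A Ω[A⁄ℂ]) := by
    by_contra! hcon
    obtain ⟨y, hy⟩ := hy
    have : (⊤ : Submodule A Ω[A⁄ℂ]) ≤ m • (⊤ : Submodule A Ω[A⁄ℂ]) := by
      rw [← KaehlerDifferential.span_range_derivation, Submodule.span_le]
      rintro _ ⟨a, rfl⟩
      rw [KaehlerDifferential.span_range_derivation]
      exact hcon a
    exact hy (this trivial)
  obtain ⟨a, ha⟩ := this
  letI := Ideal.Quotient.field m
  have : Module.Finite ℂ (A ⧸ m) := finite_of_finite_type_of_isJacobsonRing ℂ (A ⧸ m)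
  obtain ⟨c, hc⟩ := (IsAlgClosed.algebraMap_bijective_of_isIntegral (k := ℂ) (K := A ⧸ m)).2
    (Ideal.Quotient.mk m a)
  refine ⟨a - algebraMap ℂ A c, ?_, by simpa using ha⟩
  rw [← Ideal.Quotient.eq, ← hc]
  rfl

theorem etale_coordinate_exists (A : Type) [CommRing A] [IsDomain A] [Algebra ℂ A]
    [Algebra.FormallySmooth ℂ A] [Algebra.FinitePresentation ℂ A]
    (hdim : ringKrullDim A = 1)
    (N : ℕ) (M : Fin N → Ideal A) (hmax : ∀ i, (M i).IsMaximal)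
    (hdist : Function.Injective M) :
    ∃ (f g : A) (lam : Fin N → ℂ),
      Function.Injective lam ∧
      (∀ i, g ∉ M i) ∧
      (∀ i, f - algebraMap ℂ A (lam i) ∈ M i) ∧
      (letI : Algebra (Polynomial ℂ) (Localization.Away g) :=
        ((Polynomial.aeval (algebraMap A (Localization.Away g) f)).toRingHom).toAlgebra
       Algebra.FormallyEtale (Polynomial ℂ) (Localization.Away g) ∧
       Algebra.FinitePresentation (Polynomial ℂ) (Localization.Away g)) := by
  have hrank := aux_rank A hdim
  -- choice of `f`
  choose a ha hDa using fun i =>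
    haveI := hmax i
    aux_local A (M i) (aux_fiber A Ω[A⁄ℂ] hrank (M i)).1
  have hcop : Pairwise (Function.onFun IsCoprime fun i => M i ^ 2) := fun i j hij => by
    have := hmax i
    have := hmax j
    exact (Ideal.isCoprime_of_isMaximal (fun h => hij (hdist h))).pow
  let lam : Fin N → ℂ := fun i => ((i : ℕ) : ℂ)
  obtain ⟨f0, hf0⟩ := Ideal.exists_forall_sub_mem_ideal hcop
    (fun i => a i + algebraMap ℂ A (lam i))
  -- finite presentation holds for any choice of `f` and `g`
  have hfp : ∀ f g : A,
      letI : Algebra (Polynomial ℂ) (Localization.Away g) :=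
        ((Polynomial.aeval (algebraMap A (Localization.Away g) f)).toRingHom).toAlgebra
      Algebra.FinitePresentation (Polynomial ℂ) (Localization.Away g) := by
    intro f g
    letI : Algebra (Polynomial ℂ) (Localization.Away g) :=
        ((Polynomial.aeval (algebraMap A (Localization.Away g) f)).toRingHom).toAlgebra
    have : IsScalarTower ℂ (Polynomial ℂ) (Localization.Away g) :=
      .of_algebraMap_eq fun c => by
        rw [RingHom.algebraMap_toAlgebra]; simp
    have : Algebra.FinitePresentation A (Localization.Away g) :=
      IsLocalization.Away.finitePresentation g
    have : Algebra.FinitePresentation ℂ (Localization.Away g) :=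
      .trans ℂ A (Localization.Away g)
    exact .of_restrict_scalars_finitePresentation ℂ (Polynomial ℂ) (Localization.Away g)
  have hlam : Function.Injective lam := fun i j h => by
    simpa [lam, Fin.ext_iff] using h
  have hfmem : ∀ i, f0 - algebraMap ℂ A (lam i) ∈ M i := fun i => by
    have h1 := Ideal.pow_le_self two_ne_zero (hf0 i)
    have h2 := add_mem h1 (ha i)
    convert h2 using 1
    ring
  have hDf : ∀ i, KaehlerDifferential.D ℂ A f0 ∉ (M i) • (⊤ : Submodule A Ω[A⁄ℂ]) := by
    intro i h
    have h1 := aux_D_mem A (M i) _ (hf0 i)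
    apply hDa i
    have h2 := sub_mem h h1
    simpa using h2
  rcases Nat.eq_zero_or_pos N with rfl | hN
  · refine ⟨f0, 0, lam, hlam, fun i => i.elim0, fun i => i.elim0, ?_, hfp _ _⟩
    have : Subsingleton (Localization.Away (0 : A)) :=
      IsLocalization.subsingleton (M := Submonoid.powers (0 : A)) (Submonoid.mem_powers 0)
    letI : Algebra (Polynomial ℂ) (Localization.Away (0 : A)) :=
        ((Polynomial.aeval (algebraMap A (Localization.Away (0 : A)) f0)).toRingHom).toAlgebra
    exact ⟨Module.subsingleton (Localization.Away (0 : A)) _,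
      Module.subsingleton (Localization.Away (0 : A)) _⟩
  -- choice of `g` by prime avoidance
  let x := KaehlerDifferential.D ℂ A f0
  let I : Ideal A := Module.annihilator A (Ω[A⁄ℂ] ⧸ Submodule.span A {x})
  have hI : ∀ r : A, r ∈ I ↔ ∀ y : Ω[A⁄ℂ], r • y ∈ Submodule.span A {x} := by
    intro r
    rw [Module.mem_annihilator]
    refine ⟨fun h y => ?_, fun h z => ?_⟩
    · have := h (Submodule.Quotient.mk y)
      rwa [← Submodule.Quotient.mk_smul, Submodule.Quotient.mk_eq_zero] at this
    · obtain ⟨y, rfl⟩ := Submodule.Quotient.mk_surjective _ z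
      rw [← Submodule.Quotient.mk_smul, Submodule.Quotient.mk_eq_zero]
      exact h y
  have hg : ∃ g ∈ I, ∀ i, g ∉ M i := by
    by_contra! hcon
    have hsub : (I : Set A) ⊆ ⋃ i ∈ ((Finset.univ : Finset (Fin N)) : Set (Fin N)), M i := by
      intro r hr
      obtain ⟨i, hi⟩ := hcon r hr
      simp only [Finset.coe_univ, Set.mem_univ, Set.iUnion_true, Set.mem_iUnion]
      exact ⟨i, hi⟩
    obtain ⟨i, -, hi⟩ := (Ideal.subset_union_prime ⟨0, hN⟩ ⟨0, hN⟩
      (fun i _ _ _ => (hmax i).isPrime)).mp hsub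
    have := hmax i
    obtain ⟨r, hr1, hr2⟩ := (aux_fiber A Ω[A⁄ℂ] hrank (M i)).2 x (hDf i)
    exact hr1 (hi ((hI r).mpr hr2))
  obtain ⟨g, hgI, hg⟩ := hg
  refine ⟨f0, g, lam, hlam, hg, hfmem, ?_, hfp _ _⟩
  let : Algebra (Polynomial ℂ) (Localization.Away g) :=
        ((Polynomial.aeval (algebraMap A (Localization.Away g) f0)).toRingHom).toAlgebra
  refine aux_etale2 A f0 ?_ g ((hI g).mp hgI) (Localization.Away g) rfl
  intro h
  apply hDf ⟨0, hN⟩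
  rw [h]
  exact zero_mem _
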